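/- Let F be the metric fan. Then basic(F) ≥ basic(ℕ,[-1,1]). -/

import Mathlib

open Cardinal Set Topology

noncomputable section

/-- A family `Φ ⊆ C(X)` is basic if every continuous real-valued function on `X`
is a finite sum of compositions `gᵢ ∘ φᵢ` with `φᵢ ∈ Φ` and `gᵢ ∈ C(ℝ)`. -/
def IsBasicFamily {X : Type u} [TopologicalSpace X] (Φ : Set C(X, ℝ)) : Prop :=
  ∀ f : C(X, ℝ), ∃ (m : ℕ) (φ : Fin m → C(X, ℝ)) (g : Fin m → C(ℝ, ℝ)),
    (∀ i, φ i ∈ Φ) ∧ ∀ x, f x = ∑ i, g i (φ i x)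

/-- `basic(X)`: the least cardinality of a basic family for `X`. -/
def basicCard (X : Type u) [TopologicalSpace X] : Cardinal.{u} :=
  sInf { c | ∃ Φ : Set C(X, ℝ), IsBasicFamily Φ ∧ #Φ = c }

/-- `dim X ≤ n`: every continuous map of a closed subspace of `X` into the
`n`-sphere extends continuously over `X`. -/
def DimLE (X : Type u) [TopologicalSpace X] (n : ℕ) : Prop :=
  ∀ A : Set X, IsClosed A →
    ∀ f : C(A, Metric.sphere (0 : EuclideanSpace ℝ (Fin (n + 1))) 1),
      ∃ F : C(X, Metric.sphere (0 : EuclideanSpace ℝ (Fin (n + 1))) 1),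
        ∀ a : A, F a = f a

/-- A Cantor set in `Y` is a subspace homeomorphic to the Cantor space `{0,1}^ℕ`. -/
def IsCantorSet {Y : Type u} [TopologicalSpace Y] (C : Set Y) : Prop :=
  Nonempty (C ≃ₜ (ℕ → Bool))

/-- Strong independence of a family `𝒞 ⊆ C(X)`. -/
def StronglyIndep {X : Type u} [TopologicalSpace X] (𝒞 : Set C(X, ℝ)) : Prop :=
  ∀ (n : ℕ) (φ : C(X, Fin n → ℝ)),
    #(𝒞 ∩ { f : C(X, ℝ) | ∃ g : C((Fin n → ℝ), ℝ), ∀ x, f x = g (φ x) } : Set C(X, ℝ)) ≤ n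

/-- Weak independence of a family `𝒞 ⊆ C(X)`. -/
def WeaklyIndep {X : Type u} [TopologicalSpace X] (𝒞 : Set C(X, ℝ)) : Prop :=
  ∀ (n : ℕ) (φ : Fin n → C(X, ℝ)),
    #(𝒞 ∩ { f : C(X, ℝ) | ∃ g : Fin n → C(ℝ, ℝ), ∀ x, f x = ∑ i, g i (φ i x) } : Set C(X, ℝ)) < 𝔠

/-- The weight of a topological space: least cardinality of a basis. -/
def weightCard (X : Type u) [TopologicalSpace X] : Cardinal.{u} :=
  sInf { c | ∃ B : Set (Set X), TopologicalSpace.IsTopologicalBasis B ∧ #B = c }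

/-- `cof([κ]^{ℵ₀}, ⊆)`: least cardinality of a family of countably infinite subsets
of (a set of size) `κ` which is cofinal in the countably infinite subsets. -/
def cofCtblSubsets (κ : Cardinal.{u}) : Cardinal.{u} :=
  sInf { c | ∃ 𝒞 : Set (Set κ.out),
    (∀ C ∈ 𝒞, C.Countable ∧ C.Infinite) ∧
    (∀ S : Set κ.out, S.Countable → S.Infinite → ∃ C ∈ 𝒞, S ⊆ C) ∧ #𝒞 = c }


/-- The metric fan: `(ℕ × ℕ) ∪ {∗}`, points of `ℕ × ℕ` isolated, and a set `U`
containing `∗` is open iff it contains `[N,∞) × ℕ` for some `N`. -/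
def Fan : Type := (ℕ × ℕ) ⊕ Unit

instance : TopologicalSpace Fan where
  IsOpen U := Sum.inr () ∈ U → ∃ N : ℕ, ∀ p : ℕ × ℕ, N ≤ p.1 → Sum.inl p ∈ U
  isOpen_univ := fun _ => ⟨0, fun _ _ => trivial⟩
  isOpen_inter := by
    rintro s t hs ht hmem
    obtain ⟨N, hN⟩ := hs hmem.1
    obtain ⟨M, hM⟩ := ht hmem.2
    exact ⟨max N M, fun p hp =>
      ⟨hN p (le_trans (le_max_left _ _) hp), hM p (le_trans (le_max_right _ _) hp)⟩⟩
  isOpen_sUnion := by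
    intro S hS hmem
    obtain ⟨U, hU, hmemU⟩ := hmem
    obtain ⟨N, hN⟩ := hS U hU hmemU
    exact ⟨N, fun p hp => ⟨U, hU, hN p hp⟩⟩

/-- A family of functions `ℕ → [-1,1]` basic for `ℕ` into `[-1,1]`. -/
def IsBasicNatIcc (Φ : Set (ℕ → ℝ)) : Prop :=
  (∀ φ ∈ Φ, ∀ k, φ k ∈ Set.Icc (-1:ℝ) 1) ∧
  ∀ f : ℕ → ℝ, (∀ k, f k ∈ Set.Icc (-1:ℝ) 1) →
    ∃ (m : ℕ) (φ : Fin m → (ℕ → ℝ)) (g : Fin m → C(ℝ, ℝ)),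
      (∀ i, φ i ∈ Φ) ∧ ∀ k, f k = ∑ i, g i (φ i k)

/-- `basic(ℕ, [-1,1])`. -/
def basicNatIcc : Cardinal :=
  sInf { c | ∃ Φ : Set (ℕ → ℝ), IsBasicNatIcc Φ ∧ #Φ = c }

theorem Fan.continuous_of_le {f : Fan → ℝ}
    (h : ∀ ε > 0, ∃ N : ℕ, ∀ p : ℕ × ℕ, N ≤ p.1 → |f (Sum.inl p) - f (Sum.inr ())| < ε) :
    Continuous f := by
  refine continuous_def.2 fun s hs hmem => ?_
  obtain ⟨ε, hε, hball⟩ := Metric.isOpen_iff.1 hs _ hmem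
  obtain ⟨N, hN⟩ := h ε hε
  exact ⟨N, fun p hp => hball (by simpa [Real.dist_eq] using hN p hp)⟩

theorem Fan.exists_abs_sub_le_one (φ : C(Fan, ℝ)) :
    ∃ N : ℕ, ∀ n, N ≤ n → ∀ k, |φ (Sum.inl (n, k)) - φ (Sum.inr ())| ≤ 1 := by
  have h : IsOpen (φ ⁻¹' Metric.ball (φ (Sum.inr ())) 1) := Metric.isOpen_ball.preimage φ.continuous
  obtain ⟨N, hN⟩ := h (Metric.mem_ball_self one_pos)
  refine ⟨N, fun n hn k => ?_⟩
  have hmem : φ (Sum.inl (n, k)) ∈ Metric.ball (φ (Sum.inr ())) 1 := hN (n, k) hn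
  rw [Metric.mem_ball, Real.dist_eq] at hmem
  exact hmem.le

/-- The function on the fan equal to `f k / (n + 1)` at `(n, k)` and to `0` at `∗`. -/
def Fan.damped (f : ℕ → ℝ) (hf : ∀ k, f k ∈ Set.Icc (-1 : ℝ) 1) : C(Fan, ℝ) where
  toFun := Sum.elim (fun p : ℕ × ℕ => f p.2 / (p.1 + 1)) fun _ => 0
  continuous_toFun := by
    refine Fan.continuous_of_le fun ε hε => ?_
    obtain ⟨N, hN⟩ := exists_nat_one_div_lt hε
    refine ⟨N, fun p hp => ?_⟩
    have hp' : (N : ℝ) ≤ p.1 := by exact_mod_cast hp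
    simp only [Sum.elim_inl, Sum.elim_inr, sub_zero, abs_div]
    rw [abs_of_pos (by positivity : (0 : ℝ) < p.1 + 1)]
    calc |f p.2| / (p.1 + 1) ≤ 1 / (N + 1) := by
          gcongr
          exact abs_le.2 (hf p.2)
      _ < ε := hN

/-- The restriction of `φ` to the `n`-th column of the fan, translated by `φ ∗`. -/
def Fan.column (p : C(Fan, ℝ) × ℕ) (k : ℕ) : ℝ := p.1 (Sum.inl (p.2, k)) - p.1 (Sum.inr ())

theorem IsBasicFamily.isBasicNatIcc_column {Φ : Set C(Fan, ℝ)} (hΦ : IsBasicFamily Φ)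
    {T : Set (C(Fan, ℝ) × ℕ)} (hT : ∀ p ∈ T, ∀ k, |Fan.column p k| ≤ 1)
    (hdir : ∀ (m : ℕ) (φ : Fin m → C(Fan, ℝ)), (∀ i, φ i ∈ Φ) → ∃ n, ∀ i, (φ i, n) ∈ T) :
    IsBasicNatIcc (Fan.column '' T) := by
  constructor
  · rintro _ ⟨p, hp, rfl⟩ k
    exact abs_le.1 (hT p hp k)
  · intro f hf
    obtain ⟨m, φ, g, hφ, hsum⟩ := hΦ (Fan.damped f hf)
    obtain ⟨n, hn⟩ := hdir m φ hφ
    refine ⟨m, fun i => Fan.column (φ i, n),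
      fun i => ⟨fun x => (n + 1) * g i (x + φ i (Sum.inr ())), by fun_prop⟩,
      fun i => ⟨_, hn i, rfl⟩, fun k => ?_⟩
    have h : f k / (n + 1) = ∑ i, g i (φ i (Sum.inl (n, k))) := hsum (Sum.inl (n, k))
    simp only [ContinuousMap.coe_mk, Fan.column, sub_add_cancel]
    rw [← Finset.mul_sum, ← h]
    field_simp

theorem basicNatIcc_le_mk {Φ : Set C(Fan, ℝ)} (hΦ : IsBasicFamily Φ) : basicNatIcc ≤ #Φ := by
  choose N hN using Fan.exists_abs_sub_le_one
  suffices ∃ T : Set (C(Fan, ℝ) × ℕ), (∀ p ∈ T, N p.1 ≤ p.2) ∧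
      (∀ (m : ℕ) (φ : Fin m → C(Fan, ℝ)), (∀ i, φ i ∈ Φ) → ∃ n, ∀ i, (φ i, n) ∈ T) ∧
      #T ≤ #Φ by
    obtain ⟨T, hT, hdir, hcard⟩ := this
    have hbasic := hΦ.isBasicNatIcc_column (fun p hp k => hN p.1 p.2 (hT p hp) k) hdir
    have hle : basicNatIcc ≤ #(Fan.column '' T) := csInf_le' ⟨_, hbasic, rfl⟩
    exact hle.trans (mk_image_le.trans hcard)
  rcases Φ.finite_or_infinite with hfin | hinf
  · obtain ⟨n, hn⟩ := (hfin.image N).bddAbove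
    refine ⟨(fun φ => (φ, n)) '' Φ, ?_, fun m φ hφ => ⟨n, fun i => ⟨_, hφ i, rfl⟩⟩, mk_image_le⟩
    rintro _ ⟨φ, hφ, rfl⟩
    exact hn ⟨φ, hφ, rfl⟩
  · refine ⟨{p | p.1 ∈ Φ ∧ N p.1 ≤ p.2}, fun p hp => hp.2, fun m φ hφ => ?_, ?_⟩
    · obtain ⟨n, hn⟩ := (Set.finite_range fun i => N (φ i)).bddAbove
      exact ⟨n, fun i => ⟨hφ i, hn ⟨i, rfl⟩⟩⟩
    · have hΦ₀ : ℵ₀ ≤ #Φ := infinite_iff.1 hinf.to_subtype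
      calc #{p : C(Fan, ℝ) × ℕ | p.1 ∈ Φ ∧ N p.1 ≤ p.2} ≤ #(Φ ×ˢ (Set.univ : Set ℕ) : Set _) :=
            mk_le_mk_of_subset fun p hp => ⟨hp.1, trivial⟩
        _ = #Φ * ℵ₀ := by rw [mk_setProd]; simp
        _ = #Φ := mul_aleph0_eq hΦ₀

theorem isBasicFamily_univ {X : Type u} [TopologicalSpace X] :
    IsBasicFamily (Set.univ : Set C(X, ℝ)) := fun f =>
  ⟨1, fun _ => f, fun _ => ContinuousMap.id ℝ, fun _ => trivial, fun x => by simp⟩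

theorem stmt8 : basicNatIcc ≤ basicCard Fan := by
  refine le_csInf ⟨_, Set.univ, isBasicFamily_univ, rfl⟩ ?_
  rintro _ ⟨Φ, hΦ, rfl⟩
  exact basicNatIcc_le_mk hΦ

end
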